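/- arXiv:1906.11222 — 2 statements merged into one kernel-verified Lean document; each statement's English description precedes it below -/
import Mathlib

section
/- Let n = 1 and H(x,p) = |p| − e^{−|x|} for (x,p) ∈ ℝ × ℝ. Then for every k > 0 the function u_k(x) = e^{−|x|}/2 + e^{|x| − 2k}/2, x ∈ [−k, k], is the unique state-constraint viscosity solution of u(x) + H(x, u'(x)) = 0 on (−k, k), while u(x) = e^{−|x|}/2 is the unique bounded viscosity solution of u(x) + H(x, u'(x)) = 0 in ℝ. Consequently 0 ≤ u_k(x) − u(x) = (e^{|x|}/2) e^{−2k} for all x ∈ [−k, k], so u_k converges to u with exponential rate O(e^{−k}) uniformly on [−k, k]. -/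
open Metric Set MeasureTheory Filter
open scoped Topology NNReal

noncomputable section

/-- `v` is a viscosity subsolution of `v + H(x, v') = 0` in the open set `Ω ⊆ ℝ`. -/
def IsViscositySubsolutionIn1 (Ω : Set ℝ) (H : ℝ → ℝ → ℝ) (v : ℝ → ℝ) : Prop :=
  ∀ x ∈ Ω, ∀ φ : ℝ → ℝ, ContDiff ℝ 1 φ →
    IsLocalMaxOn (fun y => v y - φ y) Ω x → v x + H x (deriv φ x) ≤ 0

/-- `v` is a viscosity supersolution of `v + H(x, v') = 0` on the closure of `Ω ⊆ ℝ`. -/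
def IsViscositySupersolutionOn1 (Ω : Set ℝ) (H : ℝ → ℝ → ℝ) (v : ℝ → ℝ) : Prop :=
  ∀ x ∈ closure Ω, ∀ φ : ℝ → ℝ, ContDiff ℝ 1 φ →
    IsLocalMinOn (fun y => v y - φ y) (closure Ω) x → 0 ≤ v x + H x (deriv φ x)

/-- `v` is a state-constraint viscosity solution on `Ω ⊆ ℝ`. -/
def IsStateConstraintSolution1 (Ω : Set ℝ) (H : ℝ → ℝ → ℝ) (v : ℝ → ℝ) : Prop :=
  ContinuousOn v (closure Ω) ∧ IsViscositySubsolutionIn1 Ω H v ∧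
    IsViscositySupersolutionOn1 Ω H v

/-- Boundary profile. -/
def prof (c y : ℝ) : ℝ := Real.exp (-y) / 2 + Real.exp y * c / 2

def prof' (c y : ℝ) : ℝ := -Real.exp (-y) / 2 + Real.exp y * c / 2

lemma prof_hasDeriv (c y : ℝ) : HasDerivAt (prof c) (prof' c y) y := by
  have h1 : HasDerivAt (fun y : ℝ => Real.exp (-y)) (-Real.exp (-y)) y := by
    simpa using (hasDerivAt_neg y).exp
  have h2 := ((Real.hasDerivAt_exp y).mul_const c).div_const 2
  exact (h1.div_const 2).add h2

lemma prof_contDiff (c : ℝ) : ContDiff ℝ 1 (prof c) := by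
  unfold prof; fun_prop

lemma prof_add (c y : ℝ) (h : prof' c y ≤ 0) : prof c y + |prof' c y| = Real.exp (-y) := by
  rw [abs_of_nonpos h]; unfold prof prof'; ring

lemma prof_abs_le (c : ℝ) (hc : c ≤ 1) (y : ℝ) : prof c |y| ≤ prof c y := by
  rcases le_total 0 y with h | h
  · rw [abs_of_nonneg h]
  · rw [abs_of_nonpos h]
    unfold prof
    have : Real.exp y ≤ Real.exp (-y) := Real.exp_le_exp.2 (by linarith)
    rw [neg_neg]
    nlinarith

lemma prof_abs_le' (c : ℝ) (hc : c ≤ 1) (y : ℝ) : prof c |y| ≤ prof c (-y) := by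
  simpa using prof_abs_le c hc (-y)

lemma prof_neg_hasDeriv (c y : ℝ) :
    HasDerivAt (fun z => prof c (-z)) (-prof' c (-y)) y := by
  exact ((prof_hasDeriv c (-y)).comp y (hasDerivAt_neg y)).congr_deriv (by ring)

lemma deriv_nonpos_right {g : ℝ → ℝ} {g' x : ℝ} (hg : HasDerivAt g g' x)
    (h : ∀ᶠ y in 𝓝[>] x, g y ≤ g x) : g' ≤ 0 := by
  have h1 : Tendsto (slope g x) (𝓝[>] x) (𝓝 g') :=
    (hasDerivAt_iff_tendsto_slope.1 hg).mono_left
      (nhdsWithin_mono _ (fun y hy => ne_of_gt hy))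
  refine le_of_tendsto h1 ?_
  filter_upwards [h, self_mem_nhdsWithin] with y hy hxy
  rw [slope_def_field]
  exact div_nonpos_of_nonpos_of_nonneg (by linarith) (by have : x < y := hxy; linarith)

lemma deriv_nonneg_left {g : ℝ → ℝ} {g' x : ℝ} (hg : HasDerivAt g g' x)
    (h : ∀ᶠ y in 𝓝[<] x, g y ≤ g x) : 0 ≤ g' := by
  have h1 : Tendsto (slope g x) (𝓝[<] x) (𝓝 g') :=
    (hasDerivAt_iff_tendsto_slope.1 hg).mono_left
      (nhdsWithin_mono _ (fun y hy => ne_of_lt hy))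
  refine ge_of_tendsto h1 ?_
  filter_upwards [h, self_mem_nhdsWithin] with y hy hxy
  rw [slope_def_field]
  exact div_nonneg_of_nonpos (by linarith) (by have : y < x := hxy; linarith)

lemma prof_abs_hasDeriv_pos (c : ℝ) {x : ℝ} (hx : 0 < x) :
    HasDerivAt (fun y => prof c |y|) (prof' c x) x := by
  refine (prof_hasDeriv c x).congr_of_eventuallyEq ?_
  filter_upwards [lt_mem_nhds hx] with y hy
  rw [abs_of_pos hy]

lemma prof_abs_hasDeriv_neg (c : ℝ) {x : ℝ} (hx : x < 0) :
    HasDerivAt (fun y => prof c |y|) (-prof' c (-x)) x := by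
  refine (prof_neg_hasDeriv c x).congr_of_eventuallyEq ?_
  filter_upwards [gt_mem_nhds hx] with y hy
  rw [abs_of_neg hy]

/-- one sided information at a local extremum -/
lemma test_abs_eq (c : ℝ) {x : ℝ} (hx : x ≠ 0) {φ : ℝ → ℝ} (hφ : ContDiff ℝ 1 φ)
    (h : IsLocalExtr (fun y => prof c |y| - φ y) x) : |deriv φ x| = |prof' c (|x|)| := by
  have hd : HasDerivAt φ (deriv φ x) x := (hφ.differentiable one_ne_zero x).hasDerivAt
  rcases lt_or_gt_of_ne hx with hx | hx
  · have := h.hasDerivAt_eq_zero ((prof_abs_hasDeriv_neg c hx).sub hd)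
    rw [abs_of_neg hx, show deriv φ x = -prof' c (-x) by linarith, abs_neg]
  · have := h.hasDerivAt_eq_zero ((prof_abs_hasDeriv_pos c hx).sub hd)
    rw [abs_of_pos hx, show deriv φ x = prof' c (x) by linarith]

lemma prof_sub (c : ℝ) (Ω : Set ℝ) (hΩ : IsOpen Ω) (hc : ∀ x ∈ Ω, prof' c |x| ≤ 0) :
    IsViscositySubsolutionIn1 Ω (fun x p => |p| - Real.exp (-|x|)) (fun x => prof c |x|) := by
  intro x hx φ hφ hmax
  have hmax : IsLocalMax (fun y => prof c |y| - φ y) x := hmax.isLocalMax (hΩ.mem_nhds hx)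
  have hadd := prof_add c |x| (hc x hx)
  have hd : HasDerivAt φ (deriv φ x) x := (hφ.differentiable one_ne_zero x).hasDerivAt
  have key : |deriv φ x| ≤ |prof' c (|x|)| := by
    by_cases h0 : x = 0
    · subst h0
      have hc0 := hc 0 hx
      have hm : ∀ᶠ y in 𝓝 (0:ℝ), prof c |y| - φ y ≤ prof c |0| - φ 0 := hmax
      have h1 := deriv_nonpos_right ((prof_hasDeriv c 0).sub hd) (by
        filter_upwards [hm.filter_mono nhdsWithin_le_nhds, self_mem_nhdsWithin] with y hy h
        have h : 0 < y := h
        rw [abs_of_pos h, abs_zero] at hy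
        exact hy)
      have h2 := deriv_nonneg_left ((prof_neg_hasDeriv c 0).sub hd) (by
        filter_upwards [hm.filter_mono nhdsWithin_le_nhds, self_mem_nhdsWithin] with y hy h
        have h : y < 0 := h
        rw [abs_of_neg h, abs_zero] at hy
        simpa using hy)
      rw [abs_zero] at hc0 ⊢
      rw [neg_zero] at h2
      rw [abs_of_nonpos hc0, abs_le]
      constructor <;> linarith
    · exact (test_abs_eq c h0 hφ (Or.inr hmax)).le
  show prof c |x| + (|deriv φ x| - Real.exp (-|x|)) ≤ 0
  linarith

lemma prof_super (c : ℝ) (Ω : Set ℝ)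
    (hc : ∀ x ∈ closure Ω, prof' c |x| ≤ 0)
    (hb : ∀ x ∈ closure Ω, closure Ω ∈ 𝓝 x ∨ Real.exp (-|x|) ≤ prof c |x|) :
    IsViscositySupersolutionOn1 Ω (fun x p => |p| - Real.exp (-|x|)) (fun x => prof c |x|) := by
  intro x hx φ hφ hmin
  show 0 ≤ prof c |x| + (|deriv φ x| - Real.exp (-|x|))
  rcases hb x hx with hn | hb
  swap
  · have := abs_nonneg (deriv φ x); linarith
  have hmin : IsLocalMin (fun y => prof c |y| - φ y) x := hmin.isLocalMin hn
  have hadd := prof_add c |x| (hc x hx)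
  have hd : HasDerivAt φ (deriv φ x) x := (hφ.differentiable one_ne_zero x).hasDerivAt
  have key : |prof' c (|x|)| ≤ |deriv φ x| := by
    by_cases h0 : x = 0
    · subst h0
      have hc0 := hc 0 hx
      have hm : ∀ᶠ y in 𝓝 (0:ℝ), prof c |0| - φ 0 ≤ prof c |y| - φ y := hmin
      have h1 := deriv_nonpos_right ((prof_hasDeriv c 0).sub hd).neg (by
        filter_upwards [hm.filter_mono nhdsWithin_le_nhds, self_mem_nhdsWithin] with y hy h
        have h : 0 < y := h
        rw [abs_of_pos h, abs_zero] at hy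
        simp; linarith)
      have h2 := deriv_nonneg_left ((prof_neg_hasDeriv c 0).sub hd).neg (by
        filter_upwards [hm.filter_mono nhdsWithin_le_nhds, self_mem_nhdsWithin] with y hy h
        have h : y < 0 := h
        rw [abs_of_neg h, abs_zero] at hy
        simp; linarith)
      rw [abs_zero] at hc0 ⊢
      rw [neg_zero] at h2
      have : prof' c 0 = 0 := by linarith
      rw [this, abs_zero]
      exact abs_nonneg _
    · exact (test_abs_eq c h0 hφ (Or.inl hmin)).ge
  linarith

/-- Touching points from above are dense. -/
lemma exists_touch {Ω : Set ℝ} {v : ℝ → ℝ} {a b : ℝ} (hab : a < b) (hsub : Ioo a b ⊆ Ω)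
    (hcont : ContinuousOn v (Icc a b))
    (hv : IsViscositySubsolutionIn1 Ω (fun x p => |p| - Real.exp (-|x|)) v) (hΩ : IsOpen Ω) :
    ∃ x ∈ Ioo a b, v x ≤ Real.exp (-|x|) := by
  obtain ⟨M, hM⟩ := isCompact_Icc.exists_bound_of_continuousOn hcont
  have hmm : (a + b) / 2 ∈ Icc a b := ⟨by linarith, by linarith⟩
  have hM0 : 0 ≤ M := (norm_nonneg _).trans (hM _ hmm)
  set r := (b - a) / 2 with hr
  have hr0 : 0 < r := by rw [hr]; linarith
  set C := (2 * M + 1) / r ^ 2 with hC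
  let φ : ℝ → ℝ := fun y => C * (y - (a + b) / 2) ^ 2
  have hφ : ContDiff ℝ 1 φ := by fun_prop
  obtain ⟨x, hx, hmax⟩ := isCompact_Icc.exists_isMaxOn ⟨_, hmm⟩
    (hcont.sub hφ.continuous.continuousOn)
  have h1 : v ((a + b) / 2) - φ ((a + b) / 2) ≤ v x - φ x := hmax hmm
  have h2 := abs_le.1 (hM _ hmm)
  have h3 := abs_le.1 (hM _ hx)
  have h4 : φ ((a + b) / 2) = 0 := by simp [φ]
  have hCr : C * r ^ 2 = 2 * M + 1 := by rw [hC]; field_simp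
  have hxa : x ≠ a := by
    rintro rfl
    have : φ x = 2 * M + 1 := by rw [← hCr, hr]; simp only [φ]; ring
    linarith
  have hxb : x ≠ b := by
    rintro rfl
    have : φ x = 2 * M + 1 := by rw [← hCr, hr]; simp only [φ]; ring
    linarith
  have hxI : x ∈ Ioo a b := ⟨lt_of_le_of_ne hx.1 hxa.symm, lt_of_le_of_ne hx.2 hxb⟩
  refine ⟨x, hxI, ?_⟩
  have hloc : IsLocalMax (fun y => v y - φ y) x := hmax.isLocalMax (Icc_mem_nhds hxI.1 hxI.2)
  have := hv x (hsub hxI) φ hφ (hloc.on Ω)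
  have h5 : v x + (|deriv φ x| - Real.exp (-|x|)) ≤ 0 := this
  have := abs_nonneg (deriv φ x)
  linarith

lemma sub_le_exp {k : ℝ} (hk : 0 < k) {v : ℝ → ℝ} (hcont : ContinuousOn v (Icc (-k) k))
    (hv : IsViscositySubsolutionIn1 (Ioo (-k) k) (fun x p => |p| - Real.exp (-|x|)) v)
    {x : ℝ} (hx : x ∈ Icc (-k) k) : v x ≤ Real.exp (-|x|) := by
  let D := {y | y ∈ Ioo (-k) k ∧ v y ≤ Real.exp (-|y|)}
  have hD : D ⊆ Icc (-k) k := fun y hy => Ioo_subset_Icc_self hy.1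
  have hxD : x ∈ closure D := by
    rw [Metric.mem_closure_iff]
    intro ε hε
    have h1 : max (-k) (x - ε) < min k (x + ε) := by
      rw [max_lt_iff, lt_min_iff, lt_min_iff]
      refine ⟨⟨by linarith, by linarith [hx.1]⟩, by linarith [hx.2], by linarith⟩
    have hs : Icc (max (-k) (x - ε)) (min k (x + ε)) ⊆ Icc (-k) k :=
      Icc_subset_Icc (le_max_left _ _) (min_le_left _ _)
    have hs' : Ioo (max (-k) (x - ε)) (min k (x + ε)) ⊆ Ioo (-k) k :=
      Ioo_subset_Ioo (le_max_left _ _) (min_le_left _ _)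
    obtain ⟨y, hy, hvy⟩ := exists_touch h1 hs' (hcont.mono hs) hv isOpen_Ioo
    refine ⟨y, ⟨hs' hy, hvy⟩, ?_⟩
    rw [Real.dist_eq, abs_lt]
    have := (le_max_right (-k) (x - ε)).trans_lt hy.1
    have := hy.2.trans_le (min_le_right k (x + ε))
    constructor <;> linarith
  have hc2 : Continuous (fun y : ℝ => Real.exp (-|y|)) := by fun_prop
  exact ContinuousWithinAt.closure_le hxD ((hcont x hx).mono hD)
    hc2.continuousWithinAt (fun y hy => hy.2)

lemma prof'_nonpos {k x : ℝ} (hx : |x| ≤ k) : prof' (Real.exp (-(2 * k))) |x| ≤ 0 := by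
  unfold prof'
  rw [← Real.exp_add]
  have : Real.exp (|x| + -(2 * k)) ≤ Real.exp (-|x|) := Real.exp_le_exp.2 (by linarith)
  linarith

lemma prof_end (k : ℝ) : prof (Real.exp (-(2 * k))) k = Real.exp (-k) := by
  unfold prof
  rw [← Real.exp_add, show k + -(2 * k) = -k by ring]
  ring

lemma prof_abs_cont (c : ℝ) : Continuous (fun y : ℝ => prof c |y|) := by
  unfold prof; fun_prop

lemma sub_le_prof {k : ℝ} (hk : 0 < k) {v : ℝ → ℝ} (hcont : ContinuousOn v (Icc (-k) k))
    (hv : IsViscositySubsolutionIn1 (Ioo (-k) k) (fun x p => |p| - Real.exp (-|x|)) v)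
    {x : ℝ} (hx : x ∈ Icc (-k) k) : v x ≤ prof (Real.exp (-(2 * k))) |x| := by
  set c := Real.exp (-(2 * k)) with hc
  have hc1 : c ≤ 1 := Real.exp_le_one_iff.2 (by linarith)
  obtain ⟨z, hz, hmax⟩ := isCompact_Icc.exists_isMaxOn ⟨x, hx⟩
    (hcont.sub (prof_abs_cont c).continuousOn)
  have h1 : v x - prof c |x| ≤ v z - prof c |z| := hmax hx
  suffices v z ≤ prof c |z| by linarith
  have hzk : |z| ≤ k := abs_le.2 hz
  rcases hzk.eq_or_lt with h | h
  · have := sub_le_exp hk hcont hv hz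
    rw [h, ← prof_end k] at this
    rw [h]
    exact this
  have hzI : z ∈ Ioo (-k) k := abs_lt.1 h
  have hadd := prof_add c |z| (prof'_nonpos hzk)
  have hloc : ∀ᶠ y in 𝓝 z, v y - prof c |y| ≤ v z - prof c |z| :=
    hmax.isLocalMax (Icc_mem_nhds hzI.1 hzI.2)
  rcases le_total 0 z with h0 | h0
  · have hl : IsLocalMax (fun y => v y - prof c y) z := by
      filter_upwards [hloc] with y hy
      rw [abs_of_nonneg h0] at hy
      have := prof_abs_le c hc1 y
      linarith
    have h2 : v z + (|deriv (prof c) z| - Real.exp (-|z|)) ≤ 0 :=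
      hv z hzI _ (prof_contDiff c) (hl.on _)
    rw [(prof_hasDeriv c z).deriv] at h2
    rw [abs_of_nonneg h0] at *
    linarith
  · have hl : IsLocalMax (fun y => v y - prof c (-y)) z := by
      filter_upwards [hloc] with y hy
      rw [abs_of_nonpos h0] at hy
      have := prof_abs_le' c hc1 y
      linarith
    have h2 : v z + (|deriv (fun y => prof c (-y)) z| - Real.exp (-|z|)) ≤ 0 :=
      hv z hzI _ ((prof_contDiff c).comp contDiff_neg) (hl.on _)
    rw [(prof_neg_hasDeriv c z).deriv, abs_neg] at h2
    rw [abs_of_nonpos h0] at *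
    linarith

/-- Comparison with smooth almost-subsolutions. -/
lemma super_ge {Ω : Set ℝ} {v W W' : ℝ → ℝ} {δ : ℝ}
    (hv : IsViscositySupersolutionOn1 Ω (fun x p => |p| - Real.exp (-|x|)) v)
    (hW : ContDiff ℝ 1 W) (hW' : ∀ x, HasDerivAt W (W' x) x)
    (hs : ∀ x ∈ closure Ω, W x + |W' x| ≤ Real.exp (-|x|) + δ)
    (hmin : ∃ z ∈ closure Ω, IsMinOn (fun y => v y - W y) (closure Ω) z)
    {x : ℝ} (hx : x ∈ closure Ω) : W x - δ ≤ v x := by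
  obtain ⟨z, hz, hm⟩ := hmin
  have h1 : v z - W z ≤ v x - W x := hm hx
  have h2 : 0 ≤ v z + (|deriv W z| - Real.exp (-|z|)) := hv z hz W hW hm.localize
  rw [(hW' z).deriv] at h2
  have := hs z hz
  linarith

def sm (ε x : ℝ) : ℝ := Real.sqrt (x ^ 2 + ε ^ 2)
def sm' (ε x : ℝ) : ℝ := x / Real.sqrt (x ^ 2 + ε ^ 2)

lemma sm_pos {ε : ℝ} (hε : 0 < ε) (x : ℝ) : x ^ 2 + ε ^ 2 ≠ 0 := by positivity

lemma sm_hasDeriv {ε : ℝ} (hε : 0 < ε) (x : ℝ) : HasDerivAt (sm ε) (sm' ε x) x := by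
  have h := (((hasDerivAt_id x).pow 2).add_const (ε ^ 2)).sqrt (sm_pos hε x)
  refine h.congr_deriv ?_
  simp only [sm', id]
  simp
  ring

lemma sm_contDiff {ε : ℝ} (hε : 0 < ε) : ContDiff ℝ 1 (sm ε) := by
  unfold sm
  exact ContDiff.sqrt (by fun_prop) (sm_pos hε)

lemma abs_le_sm (ε x : ℝ) : |x| ≤ sm ε x :=
  Real.abs_le_sqrt (by nlinarith [sq_nonneg ε])

lemma sm_le {ε : ℝ} (hε : 0 < ε) (x : ℝ) : sm ε x ≤ |x| + ε := by
  unfold sm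
  rw [Real.sqrt_le_left (by positivity)]
  nlinarith [sq_abs x, abs_nonneg x]

lemma abs_sm' (ε x : ℝ) : |sm' ε x| ≤ 1 := by
  unfold sm'
  rw [abs_div, abs_of_nonneg (Real.sqrt_nonneg _)]
  exact div_le_one_of_le₀ (abs_le_sm ε x) (Real.sqrt_nonneg _)

lemma super_ge_prof {k : ℝ} (hk : 0 < k) {v : ℝ → ℝ} (hcont : ContinuousOn v (Icc (-k) k))
    (hv : IsViscositySupersolutionOn1 (Ioo (-k) k) (fun x p => |p| - Real.exp (-|x|)) v)
    {x : ℝ} (hx : x ∈ Icc (-k) k) : prof (Real.exp (-(2 * k))) |x| ≤ v x := by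
  set c := Real.exp (-(2 * k)) with hc
  have hcl : closure (Ioo (-k) k) = Icc (-k) k := closure_Ioo (by linarith)
  have main : ∀ ε > 0, prof c (sm ε x) - (Real.exp ε - 1) ≤ v x := by
    intro ε hε
    have hW : ContDiff ℝ 1 (fun y => prof c (sm ε y)) := (prof_contDiff c).comp (sm_contDiff hε)
    refine super_ge (W := fun y => prof c (sm ε y)) (W' := fun y => prof' c (sm ε y) * sm' ε y)
      hv hW (fun y => (prof_hasDeriv c _).comp y (sm_hasDeriv hε y)) ?_ ?_ (hcl ▸ hx)
    · intro y hy
      rw [hcl] at hy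
      have hyk : |y| ≤ k := abs_le.2 hy
      have h1 : |prof' c (sm ε y) * sm' ε y| ≤ |prof' c (sm ε y)| := by
        rw [abs_mul]
        exact mul_le_of_le_one_right (abs_nonneg _) (abs_sm' ε y)
      have h2 : prof c (sm ε y) + |prof' c (sm ε y)| ≤ Real.exp (-|y| + ε) := by
        rcases le_total (prof' c (sm ε y)) 0 with h | h
        · rw [prof_add c _ h]
          exact Real.exp_le_exp.2 (by linarith [abs_le_sm ε y])
        · rw [abs_of_nonneg h]
          have : prof c (sm ε y) + prof' c (sm ε y) = Real.exp (sm ε y + -(2 * k)) := by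
            rw [Real.exp_add]; unfold prof prof'; ring
          rw [this]
          exact Real.exp_le_exp.2 (by linarith [sm_le hε y])
      have h3 : Real.exp (-|y| + ε) ≤ Real.exp (-|y|) + (Real.exp ε - 1) := by
        rw [Real.exp_add]
        have e1 : Real.exp (-|y|) ≤ 1 := Real.exp_le_one_iff.2 (by linarith [abs_nonneg y])
        have e2 : 1 ≤ Real.exp ε := Real.one_le_exp hε.le
        nlinarith
      show prof c (sm ε y) + |prof' c (sm ε y) * sm' ε y| ≤ _
      linarith
    · rw [hcl]
      exact isCompact_Icc.exists_isMinOn ⟨x, hx⟩ (hcont.sub hW.continuous.continuousOn)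
  have hlim : Tendsto (fun ε => prof c (sm ε x) - (Real.exp ε - 1)) (𝓝[>] 0) (𝓝 (prof c |x|)) := by
    have hcn : Continuous (fun ε => prof c (sm ε x) - (Real.exp ε - 1)) := by
      unfold prof sm; fun_prop
    have := (hcn.tendsto 0).mono_left (nhdsWithin_le_nhds (s := Ioi 0))
    simpa [sm, Real.sqrt_sq_eq_abs] using this
  exact le_of_tendsto hlim (by filter_upwards [self_mem_nhdsWithin] with ε hε using main ε hε)

lemma super_ge_univ {v : ℝ → ℝ} (hcont : Continuous v) {M : ℝ} (hM : ∀ x, |v x| ≤ M)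
    (hv : IsViscositySupersolutionOn1 univ (fun x p => |p| - Real.exp (-|x|)) v)
    (x : ℝ) : Real.exp (-|x|) / 2 ≤ v x := by
  have main : ∀ ε > 0, (prof 0 (sm ε x) - ε * sm ε x) - ε ≤ v x := by
    intro ε hε
    have hW : ContDiff ℝ 1 (fun y => prof 0 (sm ε y) - ε * sm ε y) :=
      ((prof_contDiff 0).comp (sm_contDiff hε)).sub (contDiff_const.mul (sm_contDiff hε))
    refine super_ge (W := fun y => prof 0 (sm ε y) - ε * sm ε y)
      (W' := fun y => prof' 0 (sm ε y) * sm' ε y - ε * sm' ε y)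
      hv hW (fun y => ((prof_hasDeriv 0 _).comp y (sm_hasDeriv hε y)).sub
        ((sm_hasDeriv hε y).const_mul ε)) ?_ ?_ (by simp)
    · intro y _
      have h0 : prof' 0 (sm ε y) ≤ 0 := by
        have := Real.exp_pos (-sm ε y)
        unfold prof'; linarith
      have h1 : |prof' 0 (sm ε y) * sm' ε y - ε * sm' ε y| ≤ |prof' 0 (sm ε y)| + ε := by
        rw [← sub_mul, abs_mul]
        refine (mul_le_of_le_one_right (abs_nonneg _) (abs_sm' ε y)).trans ?_
        refine (abs_sub _ _).trans ?_
        rw [abs_of_pos hε]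
      have h2 := prof_add 0 _ h0
      have h3 : Real.exp (-sm ε y) ≤ Real.exp (-|y|) :=
        Real.exp_le_exp.2 (by linarith [abs_le_sm ε y])
      have h4 : 0 ≤ ε * sm ε y := mul_nonneg hε.le (Real.sqrt_nonneg _)
      show prof 0 (sm ε y) - ε * sm ε y + |prof' 0 (sm ε y) * sm' ε y - ε * sm' ε y| ≤ _
      linarith
    · rw [closure_univ]
      have hco : Continuous (fun y => v y - (prof 0 (sm ε y) - ε * sm ε y)) :=
        hcont.sub hW.continuous
      have ht : Tendsto (fun y => v y - (prof 0 (sm ε y) - ε * sm ε y)) (cocompact ℝ) atTop := by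
        have ha : Tendsto (fun y : ℝ => (-M - 1) + ε * ‖y‖) (cocompact ℝ) atTop :=
          tendsto_atTop_add_const_left _ _ (tendsto_norm_cocompact_atTop.const_mul_atTop hε)
        refine tendsto_atTop_mono (fun y => ?_) ha
        have e1 := (abs_le.1 (hM y)).1
        have e2 : Real.exp (-sm ε y) ≤ 1 :=
          Real.exp_le_one_iff.2 (by linarith [abs_le_sm ε y, abs_nonneg y])
        have e3 : ε * |y| ≤ ε * sm ε y := mul_le_mul_of_nonneg_left (abs_le_sm ε y) hε.le
        rw [Real.norm_eq_abs]
        unfold prof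
        linarith
      obtain ⟨z, hz⟩ := hco.exists_forall_le ht
      exact ⟨z, mem_univ _, fun y _ => hz y⟩
  have hlim : Tendsto (fun ε => (prof 0 (sm ε x) - ε * sm ε x) - ε) (𝓝[>] 0)
      (𝓝 (prof 0 |x|)) := by
    have hcn : Continuous (fun ε => (prof 0 (sm ε x) - ε * sm ε x) - ε) := by
      unfold prof sm; fun_prop
    have := (hcn.tendsto 0).mono_left (nhdsWithin_le_nhds (s := Ioi 0))
    simpa [sm, Real.sqrt_sq_eq_abs] using this
  have := le_of_tendsto hlim
    (by filter_upwards [self_mem_nhdsWithin] with ε hε using main ε hε)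
  simpa [prof] using this

lemma sub_mono {Ω Ω' : Set ℝ} {H : ℝ → ℝ → ℝ} {v : ℝ → ℝ} (h : Ω ⊆ Ω') (hΩ : IsOpen Ω)
    (hv : IsViscositySubsolutionIn1 Ω' H v) : IsViscositySubsolutionIn1 Ω H v :=
  fun x hx φ hφ hm => hv x (h hx) φ hφ ((hm.isLocalMax (hΩ.mem_nhds hx)).on _)

lemma sub_le_univ {v : ℝ → ℝ} (hcont : Continuous v)
    (hv : IsViscositySubsolutionIn1 univ (fun x p => |p| - Real.exp (-|x|)) v)
    (x : ℝ) : v x ≤ Real.exp (-|x|) / 2 := by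
  have hlim : Tendsto (fun k : ℝ => prof (Real.exp (-(2 * k))) |x|) atTop (𝓝 (prof 0 |x|)) := by
    have h1 : Tendsto (fun k : ℝ => Real.exp (-(2 * k))) atTop (𝓝 0) :=
      Real.tendsto_exp_neg_atTop_nhds_zero.comp (tendsto_id.const_mul_atTop (by norm_num))
    unfold prof
    exact ((h1.const_mul _).div_const 2).const_add _
  have := ge_of_tendsto hlim (b := v x) (by
    filter_upwards [eventually_gt_atTop 0, eventually_ge_atTop |x|] with k hk hxk
    exact sub_le_prof hk hcont.continuousOn (sub_mono (subset_univ _) isOpen_Ioo hv)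
      (abs_le.1 hxk))
  simpa [prof] using this

lemma prof_eq (k : ℝ) : (fun x : ℝ => Real.exp (-|x|) / 2 + Real.exp (|x| - 2 * k) / 2) =
    fun x => prof (Real.exp (-(2 * k))) |x| := by
  funext x
  unfold prof
  rw [← Real.exp_add]; rfl

lemma prof_eq0 : (fun x : ℝ => Real.exp (-|x|) / 2) = fun x => prof 0 |x| := by
  funext x
  simp [prof]

lemma prof'_zero (y : ℝ) : prof' 0 y ≤ 0 := by
  have := Real.exp_pos (-y)
  unfold prof'; linarith

/-- Proposition 5.13: for `H(x,p) = |p| - e^{-|x|}`, the state-constraint solution on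
`(-k,k)` is `u_k(x) = e^{-|x|}/2 + e^{|x|-2k}/2`, the solution in `ℝ` is
`u(x) = e^{-|x|}/2`, and `u_k - u = (e^{|x|}/2) e^{-2k}` on `[-k,k]`. -/
theorem one_d_control_example :
    (∀ k : ℝ, 0 < k →
      (IsStateConstraintSolution1 (Ioo (-k) k) (fun x p => |p| - Real.exp (-|x|))
        (fun x => Real.exp (-|x|) / 2 + Real.exp (|x| - 2 * k) / 2) ∧
      ∀ v : ℝ → ℝ,
        IsStateConstraintSolution1 (Ioo (-k) k) (fun x p => |p| - Real.exp (-|x|)) v →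
        EqOn v (fun x => Real.exp (-|x|) / 2 + Real.exp (|x| - 2 * k) / 2) (Icc (-k) k))) ∧
    (IsViscositySubsolutionIn1 univ (fun x p => |p| - Real.exp (-|x|))
        (fun x => Real.exp (-|x|) / 2) ∧
      IsViscositySupersolutionOn1 univ (fun x p => |p| - Real.exp (-|x|))
        (fun x => Real.exp (-|x|) / 2)) ∧
    (∀ v : ℝ → ℝ, Continuous v → (∃ M : ℝ, ∀ x, |v x| ≤ M) →
      IsViscositySubsolutionIn1 univ (fun x p => |p| - Real.exp (-|x|)) v →
      IsViscositySupersolutionOn1 univ (fun x p => |p| - Real.exp (-|x|)) v →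
      ∀ x : ℝ, v x = Real.exp (-|x|) / 2) ∧
    (∀ k : ℝ, 0 < k → ∀ x ∈ Icc (-k) k,
      0 ≤ (Real.exp (-|x|) / 2 + Real.exp (|x| - 2 * k) / 2) - Real.exp (-|x|) / 2 ∧
      (Real.exp (-|x|) / 2 + Real.exp (|x| - 2 * k) / 2) - Real.exp (-|x|) / 2 =
        (Real.exp |x| / 2) * Real.exp (-(2 * k))) := by
  refine ⟨fun k hk => ?_, ⟨?_, ?_⟩, ?_, ?_⟩
  · have hcl : closure (Ioo (-k) k) = Icc (-k) k := closure_Ioo (by linarith)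
    rw [prof_eq]
    refine ⟨⟨(prof_abs_cont _).continuousOn, ?_, ?_⟩, ?_⟩
    · exact prof_sub _ _ isOpen_Ioo (fun x hx => prof'_nonpos (abs_lt.2 hx).le)
    · refine prof_super _ _ (fun x hx => ?_) (fun x hx => ?_)
      · rw [hcl] at hx
        exact prof'_nonpos (abs_le.2 hx)
      · rw [hcl] at hx ⊢
        rcases (abs_le.2 hx).eq_or_lt with h | h
        · right
          rw [h, prof_end]
        · left
          have := abs_lt.1 h
          exact Icc_mem_nhds this.1 this.2
    · rintro v ⟨hc, h1, h2⟩ x hx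
      rw [hcl] at hc
      exact le_antisymm (sub_le_prof hk hc h1 hx) (super_ge_prof hk hc h2 hx)
  · rw [prof_eq0]
    exact prof_sub _ _ isOpen_univ (fun x _ => prof'_zero _)
  · rw [prof_eq0]
    exact prof_super _ _ (fun x _ => prof'_zero _) (fun x _ => Or.inl (by simp))
  · rintro v hc ⟨M, hM⟩ h1 h2 x
    exact le_antisymm (sub_le_univ hc h1 x) (super_ge_univ hc hM h2 x)
  · intro k _ x _
    have := Real.exp_pos (|x| - 2 * k)
    refine ⟨by linarith, ?_⟩
    rw [sub_eq_add_neg |x|, Real.exp_add]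
    ring
end
end

section
/- Let H : closure(B(0,1)) × ℝⁿ → ℝ be continuous and satisfy (H1), (H2), (H3c) and (H4). For each integer k ≥ 2 let u_k be the unique state-constraint viscosity solution of u_k(x) + H(x, Du_k(x)) = 0 on B(0, 1 − 1/k), which satisfies the a priori bound ‖u_k‖_{L^∞} ≤ C_H and is Lipschitz with constant C_H, where C_H depends only on H. Then there exists a function u, Lipschitz with constant C_H and bounded by C_H on the closure of B(0,1), such that u_k → u uniformly on every compact subset of B(0,1) as k → ∞, and u is a state-constraint viscosity solution of u(x) + H(x, Du(x)) = 0 on B(0,1), i.e. a viscosity subsolution in B(0,1) and a viscosity supersolution on the closure of B(0,1). -/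
open Metric Set MeasureTheory Filter
open scoped Topology NNReal RealInnerProductSpace

noncomputable section

abbrev Euc (n : ℕ) := EuclideanSpace ℝ (Fin n)

/-- `v` is a viscosity subsolution of `v + H(x, Dv) = 0` in the open set `Ω`. -/
def IsViscositySubsolutionIn {n : ℕ} (Ω : Set (Euc n)) (H : Euc n → Euc n → ℝ)
    (v : Euc n → ℝ) : Prop :=
  ∀ x ∈ Ω, ∀ φ : Euc n → ℝ, ContDiff ℝ 1 φ →
    IsLocalMaxOn (fun y => v y - φ y) Ω x → v x + H x (gradient φ x) ≤ 0

/-- `v` is a viscosity supersolution of `v + H(x, Dv) = 0` on the closure of `Ω`. -/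
def IsViscositySupersolutionOn {n : ℕ} (Ω : Set (Euc n)) (H : Euc n → Euc n → ℝ)
    (v : Euc n → ℝ) : Prop :=
  ∀ x ∈ closure Ω, ∀ φ : Euc n → ℝ, ContDiff ℝ 1 φ →
    IsLocalMinOn (fun y => v y - φ y) (closure Ω) x → 0 ≤ v x + H x (gradient φ x)

/-- `v` is a state-constraint viscosity solution on `Ω`. -/
def IsStateConstraintSolution {n : ℕ} (Ω : Set (Euc n)) (H : Euc n → Euc n → ℝ)
    (v : Euc n → ℝ) : Prop :=
  ContinuousOn v (closure Ω) ∧ IsViscositySubsolutionIn Ω H v ∧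
    IsViscositySupersolutionOn Ω H v

lemma gradient_add_sq {n : ℕ} (φ : Euc n → ℝ) (hφ : ContDiff ℝ 1 φ) (c : ℝ) (a x : Euc n) :
    gradient (fun y => φ y + c * ‖y - a‖ ^ 2) x = gradient φ x + (2 * c) • (x - a) := by
  apply HasGradientAt.gradient
  have h1 : HasFDerivAt φ (InnerProductSpace.toDual ℝ (Euc n) (gradient φ x)) x :=
    ((hφ.differentiable one_ne_zero) x).hasGradientAt
  have h2 : HasFDerivAt (fun y : Euc n => ‖y - a‖ ^ 2) (2 • innerSL ℝ (x - a)) x := by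
    have := (hasStrictFDerivAt_norm_sq (x - a)).hasFDerivAt.comp x ((hasFDerivAt_id x).sub_const a)
    exact this.congr_fderiv (by ext v; simp)
  have h3 := h1.add (h2.const_mul c)
  rw [hasGradientAt_iff_hasFDerivAt]
  refine h3.congr_fderiv ?_
  ext v
  simp [inner_add_left, inner_smul_left]
  ring

lemma contDiff_add_sq {n : ℕ} (φ : Euc n → ℝ) (hφ : ContDiff ℝ 1 φ) (c : ℝ) (a : Euc n) :
    ContDiff ℝ 1 (fun y => φ y + c * ‖y - a‖ ^ 2) := by
  have : ContDiff ℝ 1 (fun y : Euc n => ‖y - a‖ ^ 2) :=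
    (contDiff_norm_sq ℝ).comp (contDiff_id.sub contDiff_const)
  exact hφ.add (contDiff_const.mul this)

lemma continuous_gradient {n : ℕ} (φ : Euc n → ℝ) (hφ : ContDiff ℝ 1 φ) :
    Continuous (gradient φ) :=
  (InnerProductSpace.toDual ℝ (Euc n)).symm.continuous.comp (hφ.continuous_fderiv one_ne_zero)

lemma comparison {n : ℕ} (H : Euc n → Euc n → ℝ)
    (hH3c : ∀ R > (0:ℝ), ∃ C > (0:ℝ), ∀ x ∈ closedBall (0 : Euc n) 1,
      ∀ y ∈ closedBall (0 : Euc n) 1, ∀ p q : Euc n, ‖p‖ ≤ R → ‖q‖ ≤ R →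
        |H x p - H y p| ≤ C * ‖x - y‖ ∧ |H x p - H x q| ≤ C * ‖p - q‖)
    (CH : ℝ) (hCH : 0 < CH) (r s : ℝ) (hs : 0 < s) (hsr : s < r) (hr : r ≤ 1)
    (v w : Euc n → ℝ) (hv : IsViscositySubsolutionIn (ball (0 : Euc n) r) H v)
    (hvl : ∀ x ∈ closedBall (0 : Euc n) r, ∀ y ∈ closedBall (0 : Euc n) r,
      |v x - v y| ≤ CH * ‖x - y‖) (hvc : ContinuousOn v (closedBall 0 r))
    (hw : IsViscositySupersolutionOn (ball (0 : Euc n) s) H w)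
    (hwc : ContinuousOn w (closedBall 0 s)) :
    ∀ z ∈ closedBall (0 : Euc n) s, v z ≤ w z := by
  intro z hz
  obtain ⟨C, hC, hCl⟩ := hH3c (2 * CH) (by positivity)
  have key : ∀ ε > 0, 2 * CH * ε < r - s → v z - w z ≤ C * (2 * CH * ε) := by
    intro ε hε hεs
    set c : ℝ := 1 / (2 * ε) with hc
    have hcpos : 0 < c := by positivity
    have hcont : ContinuousOn (fun q : Euc n × Euc n => v q.1 - w q.2 - c * ‖q.1 - q.2‖ ^ 2)
        (closedBall 0 r ×ˢ closedBall 0 s) := by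
      refine ContinuousOn.sub (ContinuousOn.sub ?_ ?_) ?_
      · exact hvc.comp continuousOn_fst (fun q hq => hq.1)
      · exact hwc.comp continuousOn_snd (fun q hq => hq.2)
      · exact Continuous.continuousOn (by fun_prop)
    have hsub : closedBall (0 : Euc n) s ⊆ closedBall 0 r := closedBall_subset_closedBall hsr.le
    obtain ⟨⟨x, y⟩, ⟨hx, hy⟩, hmax⟩ :=
      ((isCompact_closedBall (0 : Euc n) r).prod (isCompact_closedBall (0 : Euc n) s)).exists_isMaxOn
      ⟨(z, z), hsub hz, hz⟩ hcont
    simp only at hx hy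
    have hm : ∀ a ∈ closedBall (0 : Euc n) r, ∀ b ∈ closedBall (0 : Euc n) s,
        v a - w b - c * ‖a - b‖ ^ 2 ≤ v x - w y - c * ‖x - y‖ ^ 2 :=
      fun a ha b hb => hmax (show (a, b) ∈ _ from ⟨ha, hb⟩)
    have hd : ‖x - y‖ ≤ 2 * CH * ε := by
      have h1 := hm y (hsub hy) y hy
      simp only [sub_self, norm_zero] at h1
      have h2 := (abs_le.mp (hvl x hx y (hsub hy))).2
      have h3 : c * ‖x - y‖ ^ 2 ≤ CH * ‖x - y‖ := by nlinarith
      rcases (norm_nonneg (x - y)).eq_or_lt with h0 | h0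
      · rw [← h0]; positivity
      · have h4 : c * ‖x - y‖ ≤ CH := by
          by_contra! hcon
          nlinarith
        rw [hc, div_mul_eq_mul_div, div_le_iff₀ (by positivity)] at h4
        linarith
    have hxb : x ∈ ball (0 : Euc n) r := by
      rw [mem_ball_zero_iff]
      rw [mem_closedBall_zero_iff] at hy
      have := norm_le_norm_add_norm_sub' x y
      linarith
    have hz0 : ContDiff ℝ 1 (fun _ : Euc n => (0 : ℝ)) := contDiff_const
    have e1 := hv x hxb _ (contDiff_add_sq _ hz0 c y) (by
      refine IsMaxOn.localize fun a ha => ?_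
      have := hm a (ball_subset_closedBall ha) y hy
      simp only [mem_ofPred_eq]; linarith)
    have e2 := hw y (by rwa [closure_ball _ hs.ne']) _ (contDiff_add_sq _ hz0 (-c) x) (by
      rw [closure_ball _ hs.ne']
      refine IsMinOn.localize fun b hb => ?_
      have := hm x hx b hb
      simp only [mem_ofPred_eq]
      rw [norm_sub_rev b x, norm_sub_rev y x]
      linarith)
    rw [gradient_add_sq _ hz0] at e1 e2
    have hg : gradient (fun _ : Euc n => (0 : ℝ)) = fun _ => 0 := by
      funext q; simp
    have hp : (2 * -c) • (y - x) = (2 * c) • (x - y) := by module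
    rw [hp] at e2
    simp only [hg, zero_add] at e1 e2
    have hpn : ‖(2 * c) • (x - y)‖ ≤ 2 * CH := by
      rw [norm_smul, Real.norm_of_nonneg (by positivity)]
      calc 2 * c * ‖x - y‖ ≤ 2 * c * (2 * CH * ε) := by gcongr
        _ = 2 * CH := by rw [hc]; field_simp
    have e3 := (abs_le.mp (hCl x (closedBall_subset_closedBall hr hx) y
      (closedBall_subset_closedBall (hsr.le.trans hr) hy) _ _ hpn hpn).1).1
    have e4 := hm z (hsub hz) z hz
    simp only [sub_self, norm_zero] at e4
    have e5 : C * ‖x - y‖ ≤ C * (2 * CH * ε) := by gcongr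
    have e6 : 0 ≤ c * ‖x - y‖ ^ 2 := by positivity
    linarith
  have hlim : Tendsto (fun ε : ℝ => C * (2 * CH * ε)) (𝓝[>] 0) (𝓝 0) := by
    have : Continuous (fun ε : ℝ => C * (2 * CH * ε)) := by fun_prop
    simpa using (this.tendsto 0).mono_left nhdsWithin_le_nhds
  have hlim2 : Tendsto (fun ε : ℝ => 2 * CH * ε) (𝓝[>] 0) (𝓝 0) := by
    have : Continuous (fun ε : ℝ => 2 * CH * ε) := by fun_prop
    simpa using (this.tendsto 0).mono_left nhdsWithin_le_nhds
  have : v z - w z ≤ 0 := by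
    refine ge_of_tendsto hlim ?_
    filter_upwards [self_mem_nhdsWithin, hlim2.eventually_lt_const (sub_pos.mpr hsr)] with ε h1 h2
    exact key ε h1 h2
  linarith

/-- Perturbed minimizers converge. -/
lemma perturbed_min {n : ℕ} (r : ℕ → ℝ) (hr : Tendsto r atTop (𝓝 1))
    (hr0 : ∀ᶠ k in atTop, 0 < r k) (hr1 : ∀ k, r k ≤ 1)
    (g : Euc n → ℝ) (gk : ℕ → Euc n → ℝ)
    (hg : ContinuousOn g (closedBall 0 1))
    (hgk : ∀ᶠ k in atTop, ContinuousOn (gk k) (closedBall 0 (r k)))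
    (hunif : ∀ ε > 0, ∀ᶠ k in atTop, ∀ x ∈ closedBall (0 : Euc n) (r k), |gk k x - g x| ≤ ε)
    (x₀ : Euc n) (hx₀ : x₀ ∈ closedBall (0 : Euc n) 1)
    (hmin : IsLocalMinOn g (closedBall 0 1) x₀) (η : ℝ) (hη : 0 < η) :
    ∀ᶠ k in atTop, ∃ x ∈ closedBall (0 : Euc n) (r k), ‖x - x₀‖ < η ∧
      IsLocalMinOn (fun y => gk k y + ‖y - x₀‖ ^ 2) (closedBall 0 (r k)) x := by
  obtain ⟨δ, hδ, hδm⟩ := Metric.mem_nhdsWithin_iff.mp hmin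
  set ρ := min η δ / 2 with hρ
  have hρ0 : 0 < ρ := by positivity
  have hρη : ρ < η := by
    have := min_le_left η δ
    have : 0 < min η δ := by positivity
    linarith
  have hρδ : ρ < δ := by
    have := min_le_right η δ
    have : 0 < min η δ := by positivity
    linarith
  have ht : Tendsto (fun k => r k • x₀) atTop (𝓝 x₀) := by
    simpa using hr.smul_const x₀
  have hmem : ∀ᶠ k in atTop, r k • x₀ ∈ closedBall (0 : Euc n) (r k) := by
    filter_upwards [hr0] with k hk
    rw [mem_closedBall_zero_iff] at hx₀ ⊢
    rw [norm_smul, Real.norm_of_nonneg hk.le]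
    nlinarith
  have ht2 : Tendsto (fun k => r k • x₀) atTop (𝓝[closedBall 0 1] x₀) :=
    tendsto_nhdsWithin_iff.mpr ⟨ht, hmem.mono fun k hk => closedBall_subset_closedBall (hr1 k) hk⟩
  have hgt : Tendsto (fun k => g (r k • x₀)) atTop (𝓝 (g x₀)) := (hg x₀ hx₀).tendsto.comp ht2
  have hgt2 : Tendsto (fun k => g (r k • x₀) + ‖r k • x₀ - x₀‖ ^ 2) atTop (𝓝 (g x₀)) := by
    have h := hgt.add (((ht.sub_const x₀).norm).pow 2)
    simpa using h
  have hρ2 : 0 < ρ ^ 2 := by positivity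
  have hball : ∀ᶠ k in atTop, r k • x₀ ∈ closedBall x₀ ρ := ht (closedBall_mem_nhds x₀ hρ0)
  filter_upwards [hgk, hmem, hball, hunif (ρ ^ 2 / 4) (by positivity),
    hgt2.eventually_lt_const (show g x₀ < g x₀ + ρ ^ 2 / 4 by linarith)] with k h1 h2 h3 h4 h5
  obtain ⟨x, ⟨hx1, hx2⟩, hxm⟩ := ((isCompact_closedBall (0 : Euc n) (r k)).inter_right
    (isClosed_closedBall (x := x₀) (ε := ρ))).exists_isMinOn ⟨_, h2, h3⟩
    (f := fun y => gk k y + ‖y - x₀‖ ^ 2)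
    ((h1.mono inter_subset_left).add (Continuous.continuousOn (by fun_prop)))
  have hxn : ‖x - x₀‖ ≤ ρ := by simpa [dist_eq_norm] using hx2
  have a1 : gk k x + ‖x - x₀‖ ^ 2 ≤ gk k (r k • x₀) + ‖r k • x₀ - x₀‖ ^ 2 := hxm ⟨h2, h3⟩
  have a2 := abs_le.mp (h4 x hx1)
  have a3 := abs_le.mp (h4 _ h2)
  have a4 : g x₀ ≤ g x := hδm ⟨by rw [mem_ball, dist_eq_norm]; linarith,
    closedBall_subset_closedBall (hr1 k) hx1⟩
  have a5 : ‖x - x₀‖ < ρ := by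
    refine lt_of_pow_lt_pow_left₀ 2 hρ0.le ?_
    linarith [a2.1, a3.2]
  refine ⟨x, hx1, by linarith, ?_⟩
  have : ball x₀ ρ ∈ 𝓝 x := isOpen_ball.mem_nhds (by rwa [mem_ball, dist_eq_norm])
  filter_upwards [mem_nhdsWithin_of_mem_nhds this, self_mem_nhdsWithin] with y hy1 hy2
  exact hxm ⟨hy2, ball_subset_closedBall hy1⟩

/-- Continuity of the equation along perturbed test functions. -/
lemma cont_eq {n : ℕ} (H : Euc n → Euc n → ℝ)
    (hHcont : ContinuousOn (Function.uncurry H) (closedBall (0 : Euc n) 1 ×ˢ (univ : Set (Euc n))))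
    (u : Euc n → ℝ) (hu : ContinuousOn u (closedBall 0 1)) (φ : Euc n → ℝ) (hφ : ContDiff ℝ 1 φ)
    (c : ℝ) (x₀ : Euc n) :
    ContinuousOn (fun x => u x + H x (gradient φ x + (2 * c) • (x - x₀))) (closedBall 0 1) := by
  have hgc := continuous_gradient φ hφ
  have h : ContinuousOn (fun x : Euc n => (x, gradient φ x + (2 * c) • (x - x₀)))
    (closedBall 0 1) := Continuous.continuousOn (by fun_prop)
  exact hu.add (hHcont.comp h (fun x hx => ⟨hx, mem_univ _⟩))

lemma stability {n : ℕ} (H : Euc n → Euc n → ℝ)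
    (hHcont : ContinuousOn (Function.uncurry H) (closedBall (0 : Euc n) 1 ×ˢ (univ : Set (Euc n))))
    (r : ℕ → ℝ) (hr : Tendsto r atTop (𝓝 1))
    (hr0 : ∀ᶠ k in atTop, 0 < r k) (hr1 : ∀ k, r k ≤ 1)
    (u : Euc n → ℝ) (uk : ℕ → Euc n → ℝ)
    (hu : ContinuousOn u (closedBall 0 1))
    (huk : ∀ᶠ k in atTop, IsStateConstraintSolution (ball (0 : Euc n) (r k)) H (uk k))
    (hunif : ∀ ε > 0, ∀ᶠ k in atTop, ∀ x ∈ closedBall (0 : Euc n) (r k), |uk k x - u x| ≤ ε) :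
    IsStateConstraintSolution (ball (0 : Euc n) 1) H u := by
  have hcb : closure (ball (0 : Euc n) 1) = closedBall 0 1 := closure_ball _ one_ne_zero
  have hukc : ∀ᶠ k in atTop, ContinuousOn (uk k) (closedBall 0 (r k)) := by
    filter_upwards [huk, hr0] with k h1 h2
    have := h1.1
    rwa [closure_ball _ h2.ne'] at this
  refine ⟨by rwa [hcb], ?_, ?_⟩
  · intro x₀ hx₀ φ hφ hmax
    have hx₀' := ball_subset_closedBall hx₀
    by_contra! hpos
    have hF := (cont_eq H hHcont u hu φ hφ 1 x₀) x₀ hx₀'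
    set F := fun x => u x + H x (gradient φ x + (2 * (1:ℝ)) • (x - x₀)) with hFdef
    have hFx : F x₀ = u x₀ + H x₀ (gradient φ x₀) := by simp [hFdef]
    rw [← hFx] at hpos
    have hev := hF.eventually (lt_mem_nhds (show F x₀ / 2 < F x₀ by linarith))
    obtain ⟨η, hη, hηm⟩ := Metric.mem_nhdsWithin_iff.mp hev
    have hn : ‖x₀‖ < 1 := by simpa using hx₀
    have hmin : IsLocalMinOn (fun y => -(u y - φ y)) (closedBall 0 1) x₀ := by
      have h1 : IsLocalMax (fun y => u y - φ y) x₀ := hmax.isLocalMax (isOpen_ball.mem_nhds hx₀)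
      exact (h1.neg).on _
    have hp := perturbed_min r hr hr0 hr1 (fun y => -(u y - φ y)) (fun k y => -(uk k y - φ y))
      (hu.sub hφ.continuous.continuousOn).neg
      (hukc.mono fun k hk => (hk.sub hφ.continuous.continuousOn).neg)
      (fun ε hε => (hunif ε hε).mono fun k hk x hx => by
        have := hk x hx
        rw [abs_sub_comm] at this
        convert this using 2; ring) x₀ hx₀' hmin (min η ((1 - ‖x₀‖) / 2))
      (lt_min hη (by linarith))
    obtain ⟨k, ⟨x, hx, hxn, hxm⟩, h0, hs, hk, hrk⟩ := (hp.and (hr0.and (huk.and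
      ((hunif (F x₀ / 4) (by linarith)).and
      (hr.eventually (lt_mem_nhds (show (1 + ‖x₀‖) / 2 < 1 by linarith))))))).exists
    have hxη := lt_of_lt_of_le hxn (min_le_left _ _)
    have hxη2 := lt_of_lt_of_le hxn (min_le_right _ _)
    have hxb : x ∈ ball (0 : Euc n) (r k) := by
      rw [mem_ball_zero_iff]
      have := norm_le_norm_add_norm_sub' x x₀
      linarith
    have e := hs.2.1 x hxb _ (contDiff_add_sq φ hφ 1 x₀) (by
      have h1 := (hxm.on_subset ball_subset_closedBall).neg
      have hfe : (fun y => uk k y - (φ y + 1 * ‖y - x₀‖ ^ 2)) =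
          (fun y => -(-(uk k y - φ y) + ‖y - x₀‖ ^ 2)) := by
        funext y
        ring
      rw [hfe]
      exact h1)
    rw [gradient_add_sq φ hφ] at e
    have e2 : F x₀ / 2 < F x := hηm ⟨by rwa [mem_ball, dist_eq_norm],
      closedBall_subset_closedBall (hr1 k) hx⟩
    have e3 := (abs_le.mp (hk x hx)).1
    have aux : ∀ t, uk k x + t ≤ 0 → u x + t ≤ u x - uk k x := fun t ht => by linarith
    have e4 : F x ≤ u x - uk k x := aux _ e
    linarith
  · intro x₀ hx₀ φ hφ hmin
    rw [hcb] at hx₀ hmin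
    by_contra! hpos
    have hF := (cont_eq H hHcont u hu φ hφ (-1) x₀) x₀ hx₀
    set F := fun x => u x + H x (gradient φ x + (2 * (-1:ℝ)) • (x - x₀)) with hFdef
    have hFx : F x₀ = u x₀ + H x₀ (gradient φ x₀) := by simp [hFdef]
    rw [← hFx] at hpos
    have hev := hF.eventually (gt_mem_nhds (show F x₀ < F x₀ / 2 by linarith))
    obtain ⟨η, hη, hηm⟩ := Metric.mem_nhdsWithin_iff.mp hev
    have hp := perturbed_min r hr hr0 hr1 (fun y => (u y - φ y)) (fun k y => (uk k y - φ y))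
      (hu.sub hφ.continuous.continuousOn)
      (hukc.mono fun k hk => (hk.sub hφ.continuous.continuousOn))
      (fun ε hε => (hunif ε hε).mono fun k hk x hx => by
        simpa using hk x hx) x₀ hx₀ hmin η hη
    obtain ⟨k, ⟨x, hx, hxη, hxm⟩, h0, hs, hk⟩ := (hp.and (hr0.and (huk.and
      (hunif (-F x₀ / 4) (by linarith))))).exists
    have hck : closure (ball (0 : Euc n) (r k)) = closedBall 0 (r k) := closure_ball _ h0.ne'
    have e := hs.2.2 x (by rwa [hck]) _ (contDiff_add_sq φ hφ (-1) x₀) (by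
      rw [hck]
      convert hxm using 1
      funext y
      ring)
    rw [gradient_add_sq φ hφ] at e
    have e2 : F x < F x₀ / 2 := hηm ⟨by rwa [mem_ball, dist_eq_norm],
      closedBall_subset_closedBall (hr1 k) hx⟩
    have e3 := (abs_le.mp (hk x hx)).2
    have aux : ∀ t, 0 ≤ uk k x + t → u x - uk k x ≤ u x + t := fun t ht => by linarith
    have e4 : u x - uk k x ≤ F x := aux _ e
    linarith

/-- Proposition 6.1: stability for the bounded-domain prototype: the solutions `u_k` on
`B(0, 1 - 1/k)` converge locally uniformly in `B(0,1)` to a state-constraint solution on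
`B(0,1)` with the same a priori bounds. -/
theorem bounded_domain_stability {n : ℕ}
    (H : Euc n → Euc n → ℝ)
    (hHcont : ContinuousOn (Function.uncurry H)
      (closure (ball (0 : Euc n) 1) ×ˢ (univ : Set (Euc n))))
    (C₁ : ℝ) (hC₁ : 0 < C₁) (hH1 : ∀ x ∈ closure (ball (0 : Euc n) 1), ∀ p : Euc n, -H x p ≤ C₁)
    (C₂ : ℝ) (hC₂ : 0 < C₂) (hH2 : ∀ x ∈ closure (ball (0 : Euc n) 1), |H x 0| ≤ C₂)
    (hH3c : ∀ R > (0:ℝ), ∃ C > (0:ℝ), ∀ x ∈ closure (ball (0 : Euc n) 1),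
      ∀ y ∈ closure (ball (0 : Euc n) 1), ∀ p q : Euc n, ‖p‖ ≤ R → ‖q‖ ≤ R →
        |H x p - H y p| ≤ C * ‖x - y‖ ∧ |H x p - H x q| ≤ C * ‖p - q‖)
    (hH4 : ∀ M : ℝ, ∃ R : ℝ, ∀ p : Euc n, R ≤ ‖p‖ →
      ∀ x ∈ closure (ball (0 : Euc n) 1), M ≤ H x p)
    (CH : ℝ) (hCH : 0 < CH)
    (uk : ℕ → Euc n → ℝ)
    (huk : ∀ k : ℕ, 2 ≤ k →
      IsStateConstraintSolution (ball (0 : Euc n) (1 - 1 / (k : ℝ))) H (uk k) ∧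
      (∀ x ∈ closure (ball (0 : Euc n) (1 - 1 / (k : ℝ))), |uk k x| ≤ CH) ∧
      LipschitzOnWith (Real.toNNReal CH) (uk k)
        (closure (ball (0 : Euc n) (1 - 1 / (k : ℝ))))) :
    ∃ u : Euc n → ℝ,
      (∀ x ∈ closure (ball (0 : Euc n) 1), |u x| ≤ CH) ∧
      LipschitzOnWith (Real.toNNReal CH) u (closure (ball (0 : Euc n) 1)) ∧
      (∀ K : Set (Euc n), K ⊆ ball (0 : Euc n) 1 → IsCompact K →
        TendstoUniformlyOn (fun k => uk k) u atTop K) ∧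
      IsStateConstraintSolution (ball (0 : Euc n) 1) H u := by

  have hcb : closure (ball (0 : Euc n) 1) = closedBall 0 1 := closure_ball _ one_ne_zero
  simp only [hcb] at hHcont hH3c ⊢
  set r : ℕ → ℝ := fun k => 1 - 1 / (k : ℝ) with hrdef
  have hr : Tendsto r atTop (𝓝 1) := by
    have := (tendsto_one_div_atTop_nhds_zero_nat (𝕜 := ℝ)).const_sub 1
    simpa [hrdef] using this
  have hr1 : ∀ k, r k ≤ 1 := fun k => by
    have : (0:ℝ) ≤ 1 / (k : ℝ) := by positivity
    simp only [hrdef]; linarith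
  have hr0 : ∀ k, 2 ≤ k → 0 < r k := fun k hk => by
    have h2 : (2 : ℝ) ≤ k := by exact_mod_cast hk
    have : 1 / (k : ℝ) ≤ 1 / 2 := one_div_le_one_div_of_le (by norm_num) h2
    simp only [hrdef]; linarith
  have hrlt : ∀ k l : ℕ, 2 ≤ k → k < l → r k < r l := fun k l hk hkl => by
    have h2 : (0 : ℝ) < k := by exact_mod_cast (by omega : 0 < k)
    have h3 : (k : ℝ) < l := by exact_mod_cast hkl
    have : 1 / (l : ℝ) < 1 / k := one_div_lt_one_div_of_lt h2 h3
    simp only [hrdef]; linarith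
  have huk' : ∀ k : ℕ, 2 ≤ k →
      IsStateConstraintSolution (ball (0 : Euc n) (r k)) H (uk k) ∧
      (∀ x ∈ closedBall (0 : Euc n) (r k), |uk k x| ≤ CH) ∧
      ContinuousOn (uk k) (closedBall 0 (r k)) ∧
      (∀ x ∈ closedBall (0 : Euc n) (r k), ∀ y ∈ closedBall (0 : Euc n) (r k),
        |uk k x - uk k y| ≤ CH * ‖x - y‖) := by
    intro k hk
    obtain ⟨a, b, c⟩ := huk k hk
    have hck : closure (ball (0 : Euc n) (r k)) = closedBall 0 (r k) :=
      closure_ball _ (hr0 k hk).ne'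
    change closure (ball (0 : Euc n) (1 - 1 / (k : ℝ))) = closedBall 0 (r k) at hck
    rw [hck] at b c
    refine ⟨a, b, c.continuousOn, fun x hx y hy => ?_⟩
    have := c.dist_le_mul x hx y hy
    rwa [Real.dist_eq, dist_eq_norm, Real.coe_toNNReal _ hCH.le] at this
  have hmono : ∀ k l : ℕ, 2 ≤ k → k ≤ l → ∀ x ∈ closedBall (0 : Euc n) (r k),
      uk l x ≤ uk k x := by
    intro k l hk hkl
    rcases hkl.eq_or_lt with rfl | hlt
    · intro x _; exact le_rfl
    have hl : 2 ≤ l := by omega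
    exact comparison H hH3c CH hCH (r l) (r k) (hr0 k hk) (hrlt k l hk hlt) (hr1 l) _ _
      (huk' l hl).1.2.1 (huk' l hl).2.2.2 (huk' l hl).2.2.1 (huk' k hk).1.2.2 (huk' k hk).2.2.1
  have hmem : ∀ x ∈ ball (0 : Euc n) 1, ∀ᶠ k in atTop, x ∈ closedBall (0 : Euc n) (r k) := by
    intro x hx
    rw [mem_ball_zero_iff] at hx
    filter_upwards [hr.eventually (lt_mem_nhds hx)] with k hk
    rw [mem_closedBall_zero_iff]; exact hk.le
  have hlim : ∀ x ∈ ball (0 : Euc n) 1, ∃ a, Tendsto (fun k => uk k x) atTop (𝓝 a) := by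
    intro x hx
    obtain ⟨N, hN⟩ := eventually_atTop.mp ((hmem x hx).and (eventually_ge_atTop 2))
    have hanti : Antitone (fun k => uk (k + N) x) := by
      intro k l hkl
      exact hmono (k + N) (l + N) (hN _ (by omega)).2 (by omega) x (hN _ (by omega)).1
    have hbdd : BddBelow (range (fun k => uk (k + N) x)) := by
      refine ⟨-CH, ?_⟩
      rintro _ ⟨k, rfl⟩
      obtain ⟨h1, h2⟩ := hN (k + N) (by omega)
      exact (abs_le.mp ((huk' _ h2).2.1 x h1)).1
    exact ⟨_, (tendsto_add_atTop_iff_nat (f := fun k => uk k x) N).mp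
      (tendsto_atTop_ciInf hanti hbdd)⟩
  choose! f hf using hlim
  have hfl : LipschitzOnWith (Real.toNNReal CH) f (ball (0 : Euc n) 1) := by
    refine LipschitzOnWith.of_dist_le_mul fun x hx y hy => ?_
    rw [Real.dist_eq, dist_eq_norm, Real.coe_toNNReal _ hCH.le]
    refine le_of_tendsto ((hf x hx).sub (hf y hy)).abs ?_
    filter_upwards [hmem x hx, hmem y hy, eventually_ge_atTop 2] with k h1 h2 h3
    exact (huk' k h3).2.2.2 x h1 y h2
  obtain ⟨u, hul, hue⟩ := hfl.extend_real
  have hut : ∀ x ∈ ball (0 : Euc n) 1, Tendsto (fun k => uk k x) atTop (𝓝 (u x)) := by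
    intro x hx
    rw [← hue hx]; exact hf x hx
  have hul' : ∀ x y, |u x - u y| ≤ CH * ‖x - y‖ := fun x y => by
    have := hul.dist_le_mul x y
    rwa [Real.dist_eq, dist_eq_norm, Real.coe_toNNReal _ hCH.le] at this
  have hunif : ∀ ε > 0, ∀ᶠ k in atTop, ∀ x ∈ closedBall (0 : Euc n) (r k),
      |uk k x - u x| ≤ ε := by
    intro ε hε
    have hδ : 0 < ε / (4 * CH) := by positivity
    have htb : TotallyBounded (ball (0 : Euc n) 1) :=
      (isCompact_closedBall (0 : Euc n) 1).totallyBounded.subset ball_subset_closedBall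
    obtain ⟨t, ht, htf, htc⟩ := Metric.finite_approx_of_totallyBounded htb _ hδ
    have hall : ∀ᶠ k in atTop, ∀ z ∈ t,
        |uk k z - u z| < ε / 2 ∧ z ∈ closedBall (0 : Euc n) (r k) := by
      rw [eventually_all_finite htf]
      intro z hz
      refine Filter.Eventually.and ?_ (hmem z (ht hz))
      have := (Metric.tendsto_nhds.mp (hut z (ht hz))) (ε / 2) (by positivity)
      simpa [Real.dist_eq] using this
    filter_upwards [hall, eventually_ge_atTop 2] with k h1 h2 x hx
    have hxb : x ∈ ball (0 : Euc n) 1 := by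
      rw [mem_closedBall_zero_iff] at hx
      rw [mem_ball_zero_iff]
      have : 0 < 1 / (k : ℝ) := by
        have : (0 : ℝ) < k := by exact_mod_cast (by omega : 0 < k)
        positivity
      simp only [hrdef] at hx; linarith
    obtain ⟨z, hz, hxz⟩ := mem_iUnion₂.mp (htc hxb)
    rw [mem_ball, dist_eq_norm] at hxz
    have a1 := abs_le.mp ((huk' k h2).2.2.2 x hx z (h1 z hz).2)
    have a2 := abs_le.mp (hul' x z)
    have a3 := abs_lt.mp (h1 z hz).1
    have a4 : CH * ‖x - z‖ ≤ ε / 4 := by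
      calc CH * ‖x - z‖ ≤ CH * (ε / (4 * CH)) := by gcongr
        _ = ε / 4 := by field_simp
    rw [abs_le]
    constructor <;> linarith [a1.1, a1.2, a2.1, a2.2, a3.1, a3.2]
  refine ⟨u, ?_, hul.lipschitzOnWith, ?_, ?_⟩
  · have hcl : IsClosed {x | |u x| ≤ CH} := isClosed_le hul.continuous.abs continuous_const
    have hsub : ball (0 : Euc n) 1 ⊆ {x | |u x| ≤ CH} := by
      intro x hx
      refine le_of_tendsto (hut x hx).abs ?_
      filter_upwards [hmem x hx, eventually_ge_atTop 2] with k h1 h2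
      exact (huk' k h2).2.1 x h1
    intro x hx
    rw [← hcb] at hx
    exact closure_minimal hsub hcl hx
  · intro K hK hKc
    rw [Metric.tendstoUniformlyOn_iff]
    intro ε hε
    have hKr : ∀ᶠ k in atTop, K ⊆ closedBall (0 : Euc n) (r k) := by
      rcases K.eq_empty_or_nonempty with rfl | hne
      · simp
      obtain ⟨z, hz, hzm⟩ := hKc.exists_isMaxOn hne continuous_norm.continuousOn
      filter_upwards [hmem z (hK hz)] with k hk x hx
      rw [mem_closedBall_zero_iff] at hk ⊢
      exact (hzm hx).trans hk
    filter_upwards [hKr, hunif (ε / 2) (by positivity)] with k h1 h2 x hx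
    rw [dist_comm, Real.dist_eq]
    linarith [h2 x (h1 hx)]
  · exact stability H hHcont r hr ((eventually_ge_atTop 2).mono hr0) hr1 u uk
      hul.continuous.continuousOn ((eventually_ge_atTop 2).mono fun k hk => (huk' k hk).1) hunif
end
end
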